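/- arXiv:1404.1140 — 2 statements merged into one kernel-verified Lean document; each statement's English description precedes it below -/
import Mathlib

section
/- (Theorem 2.) Suppose the components of E are pairwise disjoint and their union is I (so E partitions I), and π is a product policy: π(a) = ∏_{e∈E} π_e(a_e) for probability mass functions π_e on ∏_{i∈e} A_i, each assigning positive probability to every local action. Then mixture-of-experts optimization recovers the maximizing joint action: a joint action a ∈ A maximizes the mixture-of-experts value Q̂ over A if and only if it maximizes the true value Q over A. In particular, every maximizer of Q̂ is a maximizer of Q. -/
open Finset

namespace FVPOMCP

variable {I : Type*} [Fintype I] [DecidableEq I]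
variable {A : I → Type*} [∀ i, Fintype (A i)] [∀ i, DecidableEq (A i)] [∀ i, Nonempty (A i)]

/-- Restriction of a joint action `a` to the agents in `s` (written `a_s`). -/
def restrict (s : Finset I) (a : ∀ i, A i) : ∀ i : s, A i.1 := fun i => a i.1

/-- The joint action agreeing with the local action `b` on `s` and with `a` elsewhere. -/
def patch (s : Finset I) (b : ∀ i : s, A i.1) (a : ∀ i, A i) : ∀ i, A i :=
  fun i => if h : i ∈ s then b ⟨i, h⟩ else a i

/-- The conditional probability `π(b | a_e)` that a random joint action `a' ∼ π`
restricts to `b` on `s`, given that it restricts to `a_e` on `e`. -/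
noncomputable def condProb (π : (∀ i, A i) → ℝ) (e : Finset I) (a : ∀ i, A i)
    (s : Finset I) (b : ∀ i : s, A i.1) : ℝ :=
  (∑ a' : ∀ i, A i, if restrict e a' = restrict e a ∧ restrict s a' = b then π a' else 0) /
    (∑ a' : ∀ i, A i, if restrict e a' = restrict e a then π a' else 0)

/-- The conditional expectation `E_{a'∼π}[f(a') | a'_e = a_e]`. -/
noncomputable def condExp (π : (∀ i, A i) → ℝ) (e : Finset I) (a : ∀ i, A i)
    (f : (∀ i, A i) → ℝ) : ℝ :=
  (∑ a' : ∀ i, A i, if restrict e a' = restrict e a then π a' * f a' else 0) /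
    (∑ a' : ∀ i, A i, if restrict e a' = restrict e a then π a' else 0)

/-- The marginal probability `π(b)` that a random joint action restricts to `b` on `s`. -/
def margProb (π : (∀ i, A i) → ℝ) (s : Finset I) (b : ∀ i : s, A i.1) : ℝ :=
  ∑ a' : ∀ i, A i, if restrict s a' = b then π a' else 0

/-- The bias term `B_π(a)`. -/
noncomputable def bias (E : Finset (Finset I)) (Qloc : (e : Finset I) → (∀ i : e, A i.1) → ℝ)
    (π : (∀ i, A i) → ℝ) (a : ∀ i, A i) : ℝ :=
  ∑ e ∈ E, ∑ e' ∈ E.erase e,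
    ∑ b : ∀ i : (e' \ e : Finset I), A i.1,
      condProb π e a (e' \ e) b * Qloc e' (restrict e' (patch (e' \ e) b a))

theorem restrict_patch_self {I : Type*} [DecidableEq I] {A : I → Type*}
    (s : Finset I) (b : ∀ i : s, A i.1) (x : ∀ i, A i) :
    restrict s (patch s b x) = b := by
  funext i
  simp [restrict, patch]

theorem restrict_patch_of_disjoint {I : Type*} [DecidableEq I] {A : I → Type*}
    {s t : Finset I} (h : Disjoint s t) (b : ∀ i : s, A i.1) (x : ∀ i, A i) :
    restrict t (patch s b x) = restrict t x := by
  funext i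
  simp [restrict, patch, Finset.disjoint_right.mp h i.2]

theorem patch_restrict_patch {I : Type*} [DecidableEq I] {A : I → Type*}
    (s : Finset I) (b : ∀ i : s, A i.1) (x : ∀ i, A i) :
    patch s (restrict s x) (patch s b x) = x := by
  funext i
  by_cases h : i ∈ s <;> simp [restrict, patch, h]

/-- Overwriting the `e`-part by `b_e` maps the joint actions that agree with `a` on `e`
bijectively onto those that agree with `b` on `e`. -/
theorem sum_restrict_eq_patch {I : Type*} [Fintype I] [DecidableEq I] {A : I → Type*}
    [∀ i, Fintype (A i)] [∀ i, DecidableEq (A i)]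
    (e : Finset I) (a b : ∀ i, A i) (g : (∀ i, A i) → ℝ) :
    (∑ x : ∀ i, A i, if restrict e x = restrict e b then g x else 0) =
      ∑ x : ∀ i, A i, if restrict e x = restrict e a then g (patch e (restrict e b) x) else 0 := by
  rw [← Finset.sum_filter, ← Finset.sum_filter]
  refine Finset.sum_nbij' (patch e (restrict e a)) (patch e (restrict e b)) ?_ ?_ ?_ ?_ ?_
  · simp [restrict_patch_self]
  · simp [restrict_patch_self]
  · intro x hx
    rw [← (Finset.mem_filter.mp hx).2, patch_restrict_patch]
  · intro x hx
    rw [← (Finset.mem_filter.mp hx).2, patch_restrict_patch]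
  · intro x hx
    rw [← (Finset.mem_filter.mp hx).2, patch_restrict_patch]

/-- The probability of agreeing with `a` on `e` is positive if `π` is. -/
theorem sum_restrict_eq_pos {I : Type*} [Fintype I] [DecidableEq I] {A : I → Type*}
    [∀ i, Fintype (A i)] [∀ i, DecidableEq (A i)]
    {π : (∀ i, A i) → ℝ} (hπ : ∀ x, 0 < π x) (e : Finset I) (a : ∀ i, A i) :
    0 < ∑ x : ∀ i, A i, if restrict e x = restrict e a then π x else 0 := by
  rw [← Finset.sum_filter]
  exact Finset.sum_pos (fun x _ => hπ x) ⟨a, by simp⟩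

/-- Pulling out what is known: a summand depending only on the `e`-part leaves `condExp`. -/
theorem condExp_restrict_add {I : Type*} [Fintype I] [DecidableEq I] {A : I → Type*}
    [∀ i, Fintype (A i)] [∀ i, DecidableEq (A i)]
    {π : (∀ i, A i) → ℝ} (hπ : ∀ x, 0 < π x) (e : Finset I)
    (a : ∀ i, A i) (q : (∀ i : e, A i.1) → ℝ) (f : (∀ i, A i) → ℝ) :
    condExp π e a (fun x => q (restrict e x) + f x) = q (restrict e a) + condExp π e a f := by
  have hne := (sum_restrict_eq_pos hπ e a).ne'
  unfold condExp
  rw [div_eq_iff hne, add_mul, div_mul_cancel₀ _ hne, Finset.mul_sum, ← Finset.sum_add_distrib]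
  refine Finset.sum_congr rfl fun x _ => ?_
  split_ifs with h
  · simp only [h]
    ring
  · simp

/-- If `π` splits as a factor on `e` times one independent of the `e`-part, the conditional
expectation of a function independent of the `e`-part does not depend on the conditioning. -/
theorem condExp_eq_of_patch_invariant {I : Type*} [Fintype I] [DecidableEq I] {A : I → Type*}
    [∀ i, Fintype (A i)] [∀ i, DecidableEq (A i)]
    {π : (∀ i, A i) → ℝ} (e : Finset I)
    (p : (∀ i : e, A i.1) → ℝ) (hp : ∀ b, p b ≠ 0) (r f : (∀ i, A i) → ℝ)
    (hπ : ∀ x, π x = p (restrict e x) * r x)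
    (hr : ∀ b x, r (patch e b x) = r x) (hf : ∀ b x, f (patch e b x) = f x) (a b : ∀ i, A i) :
    condExp π e a f = condExp π e b f := by
  have key (c : ∀ i, A i) (g : (∀ i, A i) → ℝ) :
      (∑ x : ∀ i, A i, if restrict e x = restrict e c then p (restrict e x) * g x else 0) =
        p (restrict e c) * ∑ x : ∀ i, A i, if restrict e x = restrict e c then g x else 0 := by
    rw [Finset.mul_sum]
    refine Finset.sum_congr rfl fun x _ => ?_
    split_ifs with h
    · rw [h]
    · simp
  simp only [condExp, hπ, mul_assoc]
  rw [key, key, key, key, mul_div_mul_left _ _ (hp _), mul_div_mul_left _ _ (hp _),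
    sum_restrict_eq_patch e a b, sum_restrict_eq_patch e a b]
  simp only [hr, hf]

/-- Theorem 2. If the components of `E` partition `I` and `π` is a
product policy with positive local pmfs, then mixture-of-experts optimization recovers
the maximizing joint action: `a` maximizes `Q̂(a) = ∑_{e∈E} E_{a'∼π}[Q(a') | a'_e = a_e]`
over all joint actions iff it maximizes the true value `Q(a) = ∑_{e∈E} Q_e(a_e)`. -/
theorem mixture_of_experts_recovers_maximizer
    {I : Type*} [Fintype I] [DecidableEq I]
    {A : I → Type*} [∀ i, Fintype (A i)] [∀ i, DecidableEq (A i)] [∀ i, Nonempty (A i)]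
    (E : Finset (Finset I)) (Qloc : (e : Finset I) → (∀ i : e, A i.1) → ℝ)
    (π : (∀ i, A i) → ℝ)
    (πloc : (e : Finset I) → (∀ i : e, A i.1) → ℝ)
    (hpair : ∀ e ∈ E, ∀ e' ∈ E, e ≠ e' → Disjoint e e')
    (hcover : E.sup id = (Finset.univ : Finset I))
    (hlocpos : ∀ e ∈ E, ∀ b : ∀ i : e, A i.1, 0 < πloc e b)
    (hlocsum : ∀ e ∈ E, ∑ b : ∀ i : e, A i.1, πloc e b = 1)
    (hprod : ∀ a : ∀ i, A i, π a = ∏ e ∈ E, πloc e (restrict e a))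
    (a : ∀ i, A i) :
    (∀ a' : ∀ i, A i,
        ∑ e ∈ E, condExp π e a' (fun a'' => ∑ e' ∈ E, Qloc e' (restrict e' a'')) ≤
        ∑ e ∈ E, condExp π e a (fun a'' => ∑ e' ∈ E, Qloc e' (restrict e' a''))) ↔
    (∀ a' : ∀ i, A i,
        ∑ e ∈ E, Qloc e (restrict e a') ≤ ∑ e ∈ E, Qloc e (restrict e a)) := by
  have hπ (x : ∀ i, A i) : 0 < π x := by
    rw [hprod]
    exact Finset.prod_pos fun e he => hlocpos e he _
  have hrestrict {e e' : Finset I} (he : e ∈ E) (he' : e' ∈ E.erase e)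
      (b : ∀ i : e, A i.1) (x : ∀ i, A i) : restrict e' (patch e b x) = restrict e' x :=
    restrict_patch_of_disjoint
      (hpair e he e' (Finset.mem_of_mem_erase he') (Finset.ne_of_mem_erase he').symm) b x
  have hexpert {e : Finset I} (he : e ∈ E) (x : ∀ i, A i) :
      condExp π e x (fun a'' => ∑ e' ∈ E, Qloc e' (restrict e' a'')) =
        Qloc e (restrict e x) +
          condExp π e a (fun a'' => ∑ e' ∈ E.erase e, Qloc e' (restrict e' a'')) := by
    simp only [← Finset.add_sum_erase E _ he]
    rw [condExp_restrict_add hπ]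
    congr 1
    refine condExp_eq_of_patch_invariant e (πloc e) (fun b => (hlocpos e he b).ne')
      (fun y => ∏ e' ∈ E.erase e, πloc e' (restrict e' y)) _ (fun y => ?_) (fun b y => ?_)
      (fun b y => ?_) x a
    · rw [hprod, ← Finset.mul_prod_erase E _ he]
    · exact Finset.prod_congr rfl fun e' he' => by rw [hrestrict he he']
    · exact Finset.sum_congr rfl fun e' he' => by rw [hrestrict he he']
  refine forall_congr' fun a' => ?_
  rw [Finset.sum_congr rfl fun e he => hexpert he a', Finset.sum_congr rfl fun e he => hexpert he a,
    Finset.sum_add_distrib, Finset.sum_add_distrib, add_le_add_iff_right]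

end FVPOMCP
end

section
/- (Theorem 3.) Suppose π is component-wise: for all e, e' ∈ E, all local actions a_e, and all b̄ ∈ ∏_{i∈e'∖e} A_i, π(b̄ | a_e) = π(b̄), the marginal π-probability that a random joint action restricts to b̄ on e'∖e (independent of a_e). Suppose further that ε > 0 and the ε-condition holds: for all e ∈ E, e' ∈ N(e), all b̄ ∈ ∏_{i∈e'∖e} A_i, and all c, c' ∈ ∏_{i∈e'∩e} A_i, Q_{e'}(b̄, c) − Q_{e'}(b̄, c') ≤ ε / (|E| · |N(e)| · |A_{e'∖e}| · π(b̄)). Then mixture-of-experts optimization returns a joint action whose value lies within ε of optimal: if a* ∈ A maximizes Q over A and a^M ∈ A maximizes the mixture-of-experts value Q̂ over A, then Q(a*) − Q(a^M) ≤ ε. -/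
open Finset

namespace FVPOMCP

variable {I : Type*} [Fintype I] [DecidableEq I]
variable {A : I → Type*} [∀ i, Fintype (A i)] [∀ i, DecidableEq (A i)] [∀ i, Nonempty (A i)]

/-- The local action for `e'` agreeing with `b` on `e' ∖ e` and with `c` on `e' ∩ e`. -/
def combine (e' e : Finset I) (b : ∀ i : (e' \ e : Finset I), A i.1)
    (c : ∀ i : (e' ∩ e : Finset I), A i.1) : ∀ i : e', A i.1 :=
  fun i =>
    if h : i.1 ∈ e then c ⟨i.1, Finset.mem_inter.2 ⟨i.2, h⟩⟩
    else b ⟨i.1, Finset.mem_sdiff.2 ⟨i.2, h⟩⟩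

/-- The neighborhood `N(e)`: the components `e' ≠ e` that overlap with `e`. -/
def neighborhood (E : Finset (Finset I)) (e : Finset I) : Finset (Finset I) :=
  (E.erase e).filter fun e' => (e' ∩ e).Nonempty

lemma combine_restrict {I : Type*} [DecidableEq I] {A : I → Type*} {e e' : Finset I}
    {a x : ∀ i, A i} (h : restrict e x = restrict e a) :
    combine e' e (restrict (e' \ e) x) (restrict (e' ∩ e) a) = restrict e' x := by
  funext i
  simp only [combine, restrict]
  split_ifs with hi
  · exact (congrFun h ⟨i.1, hi⟩).symm
  · rfl

section CondExp

variable {I : Type*} [Fintype I] [DecidableEq I]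
variable {A : I → Type*} [∀ i, Fintype (A i)] [∀ i, DecidableEq (A i)]

lemma margProb_pos [∀ i, Nonempty (A i)] {π : (∀ i, A i) → ℝ} (hπ : ∀ a, 0 < π a)
    (s : Finset I) (b : ∀ i : s, A i.1) : 0 < margProb π s b := by
  have hb : restrict s (patch s b fun _ => Classical.arbitrary _) = b := by
    funext i
    simp [restrict, patch]
  refine sum_pos' (fun a _ => ?_) ⟨patch s b fun _ => Classical.arbitrary _, mem_univ _, ?_⟩
  · split_ifs
    exacts [(hπ a).le, le_rfl]
  · rw [if_pos hb]
    exact hπ _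

lemma margProb_restrict_pos {π : (∀ i, A i) → ℝ} (hπ : ∀ a, 0 < π a)
    (s : Finset I) (a : ∀ i, A i) : 0 < margProb π s (restrict s a) :=
  have : ∀ i, Nonempty (A i) := fun i => ⟨a i⟩
  margProb_pos hπ s _

lemma condExp_sum {ι : Type*} (π : (∀ i, A i) → ℝ) (e : Finset I) (a : ∀ i, A i)
    (t : Finset ι) (f : ι → (∀ i, A i) → ℝ) :
    condExp π e a (fun x => ∑ j ∈ t, f j x) = ∑ j ∈ t, condExp π e a (f j) := by
  simp only [condExp]
  rw [← sum_div, sum_comm]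
  congr 1
  refine sum_congr rfl fun x _ => ?_
  split_ifs
  · rw [mul_sum]
  · simp

/-- The conditional expectation given `a_e` of a function of `a_e` is its value there. -/
lemma condExp_restrict_self {π : (∀ i, A i) → ℝ} (hπ : ∀ a, 0 < π a) (e : Finset I)
    (a : ∀ i, A i) (f : (∀ i : e, A i.1) → ℝ) :
    condExp π e a (fun x => f (restrict e x)) = f (restrict e a) := by
  refine (div_eq_iff (margProb_restrict_pos hπ e a).ne').2 ?_
  rw [margProb, mul_sum]
  refine sum_congr rfl fun x _ => ?_
  split_ifs with h
  · simp only [h, mul_comm]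
  · simp

/-- The conditional expectation of a local payoff as a sum over the actions of the agents
of `e'` outside `e`. -/
lemma condExp_restrict (π : (∀ i, A i) → ℝ) (e e' : Finset I) (a : ∀ i, A i)
    (f : (∀ i : e', A i.1) → ℝ) :
    condExp π e a (fun x => f (restrict e' x)) =
      ∑ b : ∀ i : (e' \ e : Finset I), A i.1,
        condProb π e a (e' \ e) b * f (combine e' e b (restrict (e' ∩ e) a)) := by
  simp only [condExp, condProb, div_mul_eq_mul_div]
  rw [← sum_div]
  congr 1
  simp only [sum_mul]
  rw [sum_comm]
  refine sum_congr rfl fun x _ => ?_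
  by_cases h : restrict e x = restrict e a
  · simp [h, ite_mul, combine_restrict h]
  · simp [h]

/-- Changing the conditioning action changes the expected payoff of a component `e'` by at most
`δ`, provided every difference of its payoffs is at most `δ / (|A_{e' ∖ e}| π(b))`. -/
lemma condExp_sub_condExp_le [∀ i, Nonempty (A i)] {π : (∀ i, A i) → ℝ} (hπ : ∀ a, 0 < π a)
    {e e' : Finset I} (hcw : ∀ (a : ∀ i, A i) (b : ∀ i : (e' \ e : Finset I), A i.1),
      condProb π e a (e' \ e) b = margProb π (e' \ e) b)
    {f : (∀ i : e', A i.1) → ℝ} {δ : ℝ}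
    (hf : ∀ (b : ∀ i : (e' \ e : Finset I), A i.1) (c c' : ∀ i : (e' ∩ e : Finset I), A i.1),
      f (combine e' e b c) - f (combine e' e b c') ≤
        δ / ((Fintype.card (∀ i : (e' \ e : Finset I), A i.1) : ℝ) * margProb π (e' \ e) b))
    (a a' : ∀ i, A i) :
    condExp π e a (fun x => f (restrict e' x)) - condExp π e a' (fun x => f (restrict e' x)) ≤
      δ := by
  simp only [condExp_restrict, hcw]
  rw [← sum_sub_distrib]
  have hcard : (Fintype.card (∀ i : (e' \ e : Finset I), A i.1) : ℝ) ≠ 0 :=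
    Nat.cast_ne_zero.2 Fintype.card_ne_zero
  calc
    _ ≤ ∑ _b : ∀ i : (e' \ e : Finset I), A i.1,
          δ / (Fintype.card (∀ i : (e' \ e : Finset I), A i.1) : ℝ) := by
        refine sum_le_sum fun b _ => ?_
        have hb := margProb_pos hπ (e' \ e) b
        rw [← mul_sub]
        refine (mul_le_mul_of_nonneg_left (hf b _ _) hb.le).trans_eq ?_
        field_simp
    _ = δ := by
        rw [sum_const, card_univ, nsmul_eq_mul]
        field_simp

/-- A component disjoint from `e` has the same expected payoff given any action on `e`. -/
lemma condExp_congr_of_inter_eq_empty {π : (∀ i, A i) → ℝ} {e e' : Finset I}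
    (hcw : ∀ (a : ∀ i, A i) (b : ∀ i : (e' \ e : Finset I), A i.1),
      condProb π e a (e' \ e) b = margProb π (e' \ e) b)
    (he : e' ∩ e = ∅) (f : (∀ i : e', A i.1) → ℝ) (a a' : ∀ i, A i) :
    condExp π e a (fun x => f (restrict e' x)) =
      condExp π e a' (fun x => f (restrict e' x)) := by
  have h : restrict (e' ∩ e) a = restrict (e' ∩ e) a' := by
    funext i
    exact absurd i.2 (by simp [he])
  simp only [condExp_restrict, hcw, h]

end CondExp

/-- Theorem 3. If `π` is component-wise and the `ε`-condition on the
true local payoffs holds, then mixture-of-experts optimization returns a joint action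
whose value lies within `ε` of optimal: if `a*` maximizes `Q` and `a^M` maximizes the
mixture-of-experts value `Q̂(a) = ∑_{e∈E} E_{a'∼π}[Q(a') | a'_e = a_e]`, then
`Q(a*) − Q(a^M) ≤ ε`. -/
theorem mixture_of_experts_eps_optimal
    {I : Type*} [Fintype I] [DecidableEq I]
    {A : I → Type*} [∀ i, Fintype (A i)] [∀ i, DecidableEq (A i)] [∀ i, Nonempty (A i)]
    (E : Finset (Finset I)) (Qloc : (e : Finset I) → (∀ i : e, A i.1) → ℝ)
    (π : (∀ i, A i) → ℝ)
    (hπpos : ∀ a, 0 < π a) (hπsum : ∑ a : ∀ i, A i, π a = 1)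
    (hcw : ∀ e ∈ E, ∀ e' ∈ E, ∀ (a : ∀ i, A i) (b : ∀ i : (e' \ e : Finset I), A i.1),
      condProb π e a (e' \ e) b = margProb π (e' \ e) b)
    (ε : ℝ) (hε : 0 < ε)
    (hcond : ∀ e ∈ E, ∀ e' ∈ neighborhood E e,
      ∀ (b : ∀ i : (e' \ e : Finset I), A i.1) (c c' : ∀ i : (e' ∩ e : Finset I), A i.1),
        Qloc e' (combine e' e b c) - Qloc e' (combine e' e b c') ≤
          ε / ((E.card : ℝ) * ((neighborhood E e).card : ℝ) *
            (Fintype.card (∀ i : (e' \ e : Finset I), A i.1) : ℝ) * margProb π (e' \ e) b))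
    (astar aM : ∀ i, A i)
    (hstar : ∀ a' : ∀ i, A i,
      ∑ e ∈ E, Qloc e (restrict e a') ≤ ∑ e ∈ E, Qloc e (restrict e astar))
    (hM : ∀ a' : ∀ i, A i,
      ∑ e ∈ E, condExp π e a' (fun a'' => ∑ e' ∈ E, Qloc e' (restrict e' a'')) ≤
      ∑ e ∈ E, condExp π e aM (fun a'' => ∑ e' ∈ E, Qloc e' (restrict e' a''))) :
    (∑ e ∈ E, Qloc e (restrict e astar)) - (∑ e ∈ E, Qloc e (restrict e aM)) ≤ ε := by
  have expert : ∀ e ∈ E,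
      condExp π e aM (fun x => ∑ e' ∈ E, Qloc e' (restrict e' x)) -
        condExp π e astar (fun x => ∑ e' ∈ E, Qloc e' (restrict e' x)) ≤
      Qloc e (restrict e aM) - Qloc e (restrict e astar) + ε / E.card := by
    intro e he
    have hE : (0 : ℝ) < E.card := Nat.cast_pos.2 (card_pos.2 ⟨e, he⟩)
    rw [condExp_sum, condExp_sum, ← sum_sub_distrib, ← add_sum_erase E _ he,
      condExp_restrict_self hπpos, condExp_restrict_self hπpos]
    refine add_le_add le_rfl ?_
    have hN : neighborhood E e ⊆ E.erase e := filter_subset _ _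
    rw [← sum_subset hN fun e' he' hnot => ?_]
    · calc
        _ ≤ ∑ _e' ∈ neighborhood E e, ε / (E.card * (neighborhood E e).card) := by
            refine sum_le_sum fun e' he' => ?_
            refine condExp_sub_condExp_le hπpos (hcw e he e' (mem_of_mem_erase (hN he')))
              (fun b c c' => (hcond e he e' he' b c c').trans_eq ?_) _ _
            rw [div_div]
            ring
        _ ≤ ε / E.card := by
            rw [sum_const, nsmul_eq_mul]
            rcases (neighborhood E e).eq_empty_or_nonempty with h | h
            · simp only [h, card_empty, Nat.cast_zero, zero_mul]
              positivity
            · have : (0 : ℝ) < (neighborhood E e).card := Nat.cast_pos.2 (card_pos.2 h)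
              apply le_of_eq
              field_simp
    · have hempty : e' ∩ e = ∅ :=
        not_nonempty_iff_eq_empty.1 fun h => hnot (mem_filter.2 ⟨he', h⟩)
      exact sub_eq_zero.2 (condExp_congr_of_inter_eq_empty
        (hcw e he e' (mem_of_mem_erase he')) hempty _ _ _)
  have total := sum_le_sum expert
  rw [sum_add_distrib, sum_sub_distrib, sum_sub_distrib, sum_const, nsmul_eq_mul] at total
  have hε' : (E.card : ℝ) * (ε / E.card) ≤ ε := by
    rcases E.eq_empty_or_nonempty with h | h
    · simpa [h] using hε.le
    · have : (0 : ℝ) < E.card := Nat.cast_pos.2 (card_pos.2 h)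
      exact (mul_div_cancel₀ ε this.ne').le
  linarith [hM astar]

end FVPOMCP
end
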